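/- For every complex n × n matrix (σ_{αβ}) and every sign ε = ±1: [ (1/2) Σ_{α ≠ β} σ_{αβ} (γ'_{2α−1} γ'_{2β−1} + γ'_{2α} γ'_{2β}) + (i/2) Σ_{α,β} σ_{αβ} (γ'_{2α} γ'_{2β−1} − γ'_{2α−1} γ'_{2β}) ] · u(ε,…,ε) = ε · (Σ_{α=1}^{n} σ_{αα}) · u(ε,…,ε). In particular the element on the left acts on the line ℂ·u(ε,…,ε) as multiplication by ε times the trace of (σ_{αβ}). -/

import Mathlib

open Matrix Complex

noncomputable section

/-- The 2×2 matrix `U = [[i,0],[0,-i]]`. -/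
def matU : Matrix (Fin 2) (Fin 2) ℂ := !![Complex.I, 0; 0, -Complex.I]

/-- The 2×2 matrix `V = [[0,i],[i,0]]`. -/
def matV : Matrix (Fin 2) (Fin 2) ℂ := !![0, Complex.I; Complex.I, 0]

/-- The 2×2 identity matrix `E`. -/
def matE : Matrix (Fin 2) (Fin 2) ℂ := !![1, 0; 0, 1]

/-- The 2×2 matrix `T = [[0,-i],[i,0]]`. -/
def matT : Matrix (Fin 2) (Fin 2) ℂ := !![0, -Complex.I; Complex.I, 0]

/-- `epsC k j = ε_j`:  `-1` for `j ≤ k` and `1` for `j > k` (1-based index `j`). -/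
def epsC (k j : ℕ) : ℂ := if j ≤ k then -1 else 1

/-- `tauC k j = τ_j`:  `i` for `j ≤ k` and `1` for `j > k` (1-based index `j`). -/
def tauC (k j : ℕ) : ℂ := if j ≤ k then Complex.I else 1

/-- The 2×2 factor sitting in slot `α` (0-based, slot `0` is the leftmost tensor factor)
of the iterated Kronecker product defining `γ_l` (1-based `l`): for `l = 2j-1` resp.
`l = 2j` this product is `E^{⊗(m-j)} ⊗ U ⊗ T^{⊗(j-1)}` resp. `E^{⊗(m-j)} ⊗ V ⊗ T^{⊗(j-1)}`. -/
def gammaFac (m l : ℕ) (α : Fin m) : Matrix (Fin 2) (Fin 2) ℂ :=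
  if (α : ℕ) < m - (l + 1) / 2 then matE
  else if (α : ℕ) = m - (l + 1) / 2 then (if l % 2 = 1 then matU else matV) else matT

/-- `γ_l = τ_l · (E^{⊗(m-j)} ⊗ U/V ⊗ T^{⊗(j-1)})` as a `2^m × 2^m` matrix whose rows and
columns are indexed by `Fin m → Fin 2` (identifying `ℂ^{2^m}` with the `m`-fold Kronecker
power of `ℂ²`, slot `0` being the leftmost factor). -/
def gammaM (m k l : ℕ) : Matrix (Fin m → Fin 2) (Fin m → Fin 2) ℂ :=
  Matrix.of fun i i' => tauC k l * ∏ α, gammaFac m l α (i α) (i' α)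

/-- `u(δ) = (1/√2)(1, -δ i) ∈ ℂ²`. -/
def uVec (δ : ℤ) : Fin 2 → ℂ :=
  fun t => if t = 0 then (Real.sqrt 2 : ℂ)⁻¹ else -(δ : ℂ) * Complex.I * (Real.sqrt 2 : ℂ)⁻¹

/-- `u(δ₁,…,δ_m) = u(δ₁) ⊗ ⋯ ⊗ u(δ_m) ∈ ℂ^{2^m}`. -/
def uProd (m : ℕ) (δ : Fin m → ℤ) : (Fin m → Fin 2) → ℂ :=
  fun i => ∏ α, uVec (δ α) (i α)

/-- The standard Hermitian inner product, conjugate-linear in the second argument. -/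
def hermIP {ι : Type*} [Fintype ι] (x y : ι → ℂ) : ℂ :=
  ∑ i, x i * (starRingEnd ℂ) (y i)

/-- The product `γ_1 γ_2 ⋯ γ_{2m}`. -/
def gammaVol (m k : ℕ) : Matrix (Fin m → Fin 2) (Fin m → Fin 2) ℂ :=
  ((List.range (2 * m)).map fun l => gammaM m k (l + 1)).prod

/-- The eigenspace `Δ^ε_{2m,k}` of `γ_1 γ_2 ⋯ γ_{2m}` for the eigenvalue `ε · i^{m+k}`. -/
def DeltaSp (m k : ℕ) (ε : ℤ) : Submodule ℂ ((Fin m → Fin 2) → ℂ) :=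
  Module.End.eigenspace (Matrix.toLin' (gammaVol m k)) ((ε : ℂ) * Complex.I ^ (m + k))

/-- The indefinite inner product `⟨u,v⟩ := (γ_1 u, v)` (here `k = 1`). -/
def indefIP (m : ℕ) (u v : (Fin m → Fin 2) → ℂ) : ℂ :=
  hermIP ((gammaM m 1 1).mulVec u) v

/-- The canonical vector `V_u` of a spinor `u`, with components
`(V_u)_j = -ε_j ⟨γ_j u, u⟩` (here `k = 1`). -/
def canV (m : ℕ) (u : (Fin m → Fin 2) → ℂ) : Fin (2 * m) → ℂ :=
  fun j => -(epsC 1 ((j : ℕ) + 1)) * indefIP m ((gammaM m 1 ((j : ℕ) + 1)).mulVec u) u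

/-- `x ⊗ v` under the identification `ℂ^{2^{n+1}} = ℂ^{2^n} ⊗ ℂ²` (the `ℂ²` factor last). -/
def tensP (n : ℕ) (x : (Fin n → Fin 2) → ℂ) (v : Fin 2 → ℂ) : (Fin (n + 1) → Fin 2) → ℂ :=
  fun i => x (Fin.init i) * v (i (Fin.last n))

/-- `Ω₀ = Σ_α γ'_{2α-1} γ'_{2α}` (here `k = 0`). -/
def OmegaZero (n : ℕ) : Matrix (Fin n → Fin 2) (Fin n → Fin 2) ℂ :=
  ∑ α : Fin n, gammaM n 0 (2 * (α : ℕ) + 1) * gammaM n 0 (2 * (α : ℕ) + 2)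

end

lemma prod_mulVec_prod {ι κ : Type*} [Fintype ι] [DecidableEq ι] [Fintype κ]
    (A : ι → Matrix κ κ ℂ) (w : ι → κ → ℂ) :
    (Matrix.of fun i i' : ι → κ => ∏ α, A α (i α) (i' α)) *ᵥ (fun i => ∏ α, w α (i α)) =
      fun i => ∏ α, (A α *ᵥ w α) (i α) := by
  funext i
  simp only [Matrix.mulVec, dotProduct, Matrix.of_apply, ← Finset.prod_mul_distrib]
  exact (Fintype.prod_sum fun α t => A α (i α) t * w α t).symm

lemma matU_mulVec_uVec (δ : ℤ) : matU *ᵥ uVec δ = Complex.I • uVec (-δ) := by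
  funext t
  fin_cases t <;> simp [matU, uVec, Matrix.mulVec, dotProduct]

lemma matV_mulVec_uVec {δ : ℤ} (hδ : δ = 1 ∨ δ = -1) :
    matV *ᵥ uVec δ = (δ : ℂ) • uVec (-δ) := by
  funext t
  rcases hδ with rfl | rfl <;> fin_cases t <;>
    simp [matV, uVec, Matrix.mulVec, dotProduct, ← mul_assoc]

lemma matT_mulVec_uVec {δ : ℤ} (hδ : δ = 1 ∨ δ = -1) :
    matT *ᵥ uVec δ = (-δ : ℂ) • uVec δ := by
  funext t
  rcases hδ with rfl | rfl <;> fin_cases t <;>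
    simp [matT, uVec, Matrix.mulVec, dotProduct, ← mul_assoc]

lemma matE_mulVec (v : Fin 2 → ℂ) : matE *ᵥ v = v := by
  rw [show matE = 1 from Matrix.one_fin_two.symm, Matrix.one_mulVec]

/-- The scalar by which the `T` factors to the right of slot `s` act on `u(δ)`. -/
noncomputable def tailSign {n : ℕ} (s : Fin n) (δ : Fin n → ℤ) : ℂ :=
  ∏ α, if s < α then (-δ α : ℂ) else 1

lemma tailSign_update {n : ℕ} (s : Fin n) (δ : Fin n → ℤ) (d : ℤ) :
    tailSign s (Function.update δ s d) = tailSign s δ := by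
  refine Finset.prod_congr rfl fun α _ => ?_
  split_ifs with h
  · rw [Function.update_of_ne h.ne']
  · rfl

lemma tailSign_mul_self {n : ℕ} (s : Fin n) {δ : Fin n → ℤ} (hδ : ∀ α, δ α = 1 ∨ δ α = -1) :
    tailSign s δ * tailSign s δ = 1 := by
  rw [tailSign, ← Finset.prod_mul_distrib]
  refine Finset.prod_eq_one fun α _ => ?_
  split_ifs
  · rcases hδ α with h | h <;> simp [h]
  · exact one_mul 1

lemma gammaM_mulVec_uProd {n l : ℕ} (a : Fin n) (hl : (l + 1) / 2 = a + 1)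
    {δ : Fin n → ℤ} (hδ : ∀ α, δ α = 1 ∨ δ α = -1) {x : ℂ}
    (hx : (if l % 2 = 1 then matU else matV) *ᵥ uVec (δ a.rev) = x • uVec (-δ a.rev)) :
    gammaM n 0 l *ᵥ uProd n δ =
      (x * tailSign a.rev δ) • uProd n (Function.update δ a.rev (-δ a.rev)) := by
  have hτ : tauC 0 l = 1 := if_neg (by omega)
  have hfac (α : Fin n) : gammaFac n l α *ᵥ uVec (δ α) =
      ((if α = a.rev then x else 1) * (if a.rev < α then (-δ α : ℂ) else 1)) •
        uVec (Function.update δ a.rev (-δ a.rev) α) := by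
    have hs : n - (l + 1) / 2 = a.rev := by rw [hl, Fin.val_rev]
    rw [gammaFac, hs]
    rcases lt_trichotomy α a.rev with h | rfl | h
    · rw [if_pos (Fin.lt_def.1 h), if_neg h.ne, if_neg h.not_gt, Function.update_of_ne h.ne,
        matE_mulVec]
      simp
    · simpa using hx
    · have h' : (a.rev : ℕ) < α := h
      rw [if_neg h'.not_gt, if_neg h'.ne', if_neg h.ne', if_pos h, Function.update_of_ne h.ne',
        matT_mulVec_uVec (hδ α), one_mul]
  have hprod := prod_mulVec_prod (gammaFac n l) fun α => uVec (δ α)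
  simp only [gammaM, hτ, one_mul]
  refine hprod.trans ?_
  funext i
  simp only [hfac, Pi.smul_apply, smul_eq_mul, Finset.prod_mul_distrib, tailSign, uProd,
    Finset.prod_ite_eq', Finset.mem_univ, if_true]

section

variable {n : ℕ} {δ : Fin n → ℤ} (a : Fin n)

lemma gammaM_odd_mulVec_uProd (hδ : ∀ α, δ α = 1 ∨ δ α = -1) :
    gammaM n 0 (2 * (a : ℕ) + 1) *ᵥ uProd n δ =
      (Complex.I * tailSign a.rev δ) • uProd n (Function.update δ a.rev (-δ a.rev)) :=
  gammaM_mulVec_uProd a (by omega) hδ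
    (by rw [if_pos (by omega)]; exact matU_mulVec_uVec _)

lemma gammaM_even_mulVec_uProd (hδ : ∀ α, δ α = 1 ∨ δ α = -1) :
    gammaM n 0 (2 * (a : ℕ) + 2) *ᵥ uProd n δ =
      (δ a.rev * tailSign a.rev δ) • uProd n (Function.update δ a.rev (-δ a.rev)) :=
  gammaM_mulVec_uProd a (by omega) hδ
    (by rw [if_neg (by omega)]; exact matV_mulVec_uVec (hδ _))

end

lemma update_neg_eq_one_or {n : ℕ} {δ : Fin n → ℤ} (hδ : ∀ α, δ α = 1 ∨ δ α = -1)
    (s α : Fin n) :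
    Function.update δ s (-δ s) α = 1 ∨ Function.update δ s (-δ s) α = -1 := by
  rcases eq_or_ne α s with rfl | h
  · rw [Function.update_self]
    have := hδ α
    omega
  · rw [Function.update_of_ne h]
    exact hδ α

lemma gammaM_add_mulVec_uProd {n : ℕ} {ε : ℤ} (hε : ε = 1 ∨ ε = -1) {α β : Fin n} (h : α ≠ β) :
    (gammaM n 0 (2 * (α : ℕ) + 1) * gammaM n 0 (2 * (β : ℕ) + 1) +
      gammaM n 0 (2 * (α : ℕ) + 2) * gammaM n 0 (2 * (β : ℕ) + 2)) *ᵥ uProd n (fun _ => ε) = 0 := by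
  have hδ : ∀ _ : Fin n, ε = 1 ∨ ε = -1 := fun _ => hε
  have hδ' := update_neg_eq_one_or hδ β.rev
  have hr : α.rev ≠ β.rev := Fin.rev_injective.ne h
  rw [Matrix.add_mulVec, ← Matrix.mulVec_mulVec, ← Matrix.mulVec_mulVec,
    gammaM_odd_mulVec_uProd β hδ, gammaM_even_mulVec_uProd β hδ, Matrix.mulVec_smul,
    Matrix.mulVec_smul, gammaM_odd_mulVec_uProd α hδ', gammaM_even_mulVec_uProd α hδ',
    smul_smul, smul_smul, ← add_smul, Function.update_of_ne hr]
  convert zero_smul ℂ _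
  have hsq : (ε : ℂ) * ε = 1 := by rcases hε with rfl | rfl <;> norm_num
  linear_combination tailSign β.rev (fun _ => ε) *
    tailSign α.rev (Function.update (fun _ => ε) β.rev (-ε)) * (Complex.I_mul_I + hsq)

lemma gammaM_sub_mulVec_uProd {n : ℕ} {ε : ℤ} (hε : ε = 1 ∨ ε = -1) (α β : Fin n) :
    (gammaM n 0 (2 * (α : ℕ) + 2) * gammaM n 0 (2 * (β : ℕ) + 1) -
      gammaM n 0 (2 * (α : ℕ) + 1) * gammaM n 0 (2 * (β : ℕ) + 2)) *ᵥ uProd n (fun _ => ε) =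
      (if α = β then -2 * Complex.I * ε else 0) • uProd n (fun _ => ε) := by
  have hδ : ∀ _ : Fin n, ε = 1 ∨ ε = -1 := fun _ => hε
  have hδ' := update_neg_eq_one_or hδ β.rev
  rw [Matrix.sub_mulVec, ← Matrix.mulVec_mulVec, ← Matrix.mulVec_mulVec,
    gammaM_odd_mulVec_uProd β hδ, gammaM_even_mulVec_uProd β hδ, Matrix.mulVec_smul,
    Matrix.mulVec_smul, gammaM_odd_mulVec_uProd α hδ', gammaM_even_mulVec_uProd α hδ',
    smul_smul, smul_smul, ← sub_smul]
  split_ifs with h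
  · subst h
    rw [tailSign_update, Function.update_self, Function.update_idem, neg_neg,
      Function.update_eq_self α.rev (fun _ => ε)]
    congr 1
    push_cast
    linear_combination (-2 * Complex.I * ε) * tailSign_mul_self α.rev hδ
  · rw [Function.update_of_ne (Fin.rev_injective.ne h), zero_smul]
    convert zero_smul ℂ _
    ring

/-- for every complex `n × n` matrix `(σ_{αβ})` and sign `ε`, the element
`(1/2) Σ_{α≠β} σ_{αβ}(γ'_{2α-1}γ'_{2β-1} + γ'_{2α}γ'_{2β})
 + (i/2) Σ_{α,β} σ_{αβ}(γ'_{2α}γ'_{2β-1} - γ'_{2α-1}γ'_{2β})`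
acts on `u(ε,…,ε)`, and hence on the line `ℂ·u(ε,…,ε)`, as multiplication by
`ε · Σ_α σ_{αα}` (i.e. `ε` times the trace of `σ`). -/
theorem one_one_form_action_on_extreme_spinor (n : ℕ) (hn : 1 ≤ n)
    (σ : Matrix (Fin n) (Fin n) ℂ) (ε : ℤ) (hε : ε = 1 ∨ ε = -1)
    (M : Matrix (Fin n → Fin 2) (Fin n → Fin 2) ℂ)
    (hM : M = (2 : ℂ)⁻¹ • (∑ α : Fin n, ∑ β : Fin n,
        if α ≠ β then
          σ α β • (gammaM n 0 (2 * (α : ℕ) + 1) * gammaM n 0 (2 * (β : ℕ) + 1) +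
            gammaM n 0 (2 * (α : ℕ) + 2) * gammaM n 0 (2 * (β : ℕ) + 2))
        else 0) +
      (Complex.I / 2) • (∑ α : Fin n, ∑ β : Fin n,
        σ α β • (gammaM n 0 (2 * (α : ℕ) + 2) * gammaM n 0 (2 * (β : ℕ) + 1) -
          gammaM n 0 (2 * (α : ℕ) + 1) * gammaM n 0 (2 * (β : ℕ) + 2)))) :
    M.mulVec (uProd n fun _ => ε) =
      ((ε : ℂ) * ∑ α, σ α α) • uProd n (fun _ => ε) ∧
    ∀ v ∈ Submodule.span ℂ {uProd n fun _ => ε},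
      M.mulVec v = ((ε : ℂ) * ∑ α, σ α α) • v := by
  have key : M.mulVec (uProd n fun _ => ε) =
      ((ε : ℂ) * ∑ α, σ α α) • uProd n (fun _ => ε) := by
    have hadd (α β : Fin n) : (if α ≠ β then
          σ α β • (gammaM n 0 (2 * (α : ℕ) + 1) * gammaM n 0 (2 * (β : ℕ) + 1) +
            gammaM n 0 (2 * (α : ℕ) + 2) * gammaM n 0 (2 * (β : ℕ) + 2))
        else 0) *ᵥ uProd n (fun _ => ε) = 0 := by
      split_ifs with h
      · rw [Matrix.smul_mulVec, gammaM_add_mulVec_uProd hε h, smul_zero]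
      · exact Matrix.zero_mulVec _
    rw [hM]
    simp only [Matrix.add_mulVec _ _ (uProd n fun _ => ε), Matrix.smul_mulVec, Matrix.sum_mulVec,
      hadd, gammaM_sub_mulVec_uProd hε]
    simp only [Finset.sum_const_zero, smul_zero, zero_add, ite_smul, zero_smul, smul_ite,
      Finset.sum_ite_eq, Finset.mem_univ, if_true, smul_smul, ← Finset.sum_smul]
    rw [← Finset.sum_mul]
    congr 1
    linear_combination (-ε * ∑ α, σ α α) * Complex.I_mul_I
  refine ⟨key, fun v hv => ?_⟩
  obtain ⟨c, rfl⟩ := Submodule.mem_span_singleton.1 hv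
  rw [Matrix.mulVec_smul, key, smul_comm]
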